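/- If T is a distribution on ℝⁿ with supp T = {x₀}, then there exist m ∈ ℕ and complex constants c_ν for multi-indices ν with |ν| ≤ m such that T = Σ_{|ν| ≤ m} c_ν D^ν δ_{x₀}. -/

import Mathlib

/-- The `i`-th partial derivative of a function on ℝⁿ. -/
noncomputable def pderivI {n : ℕ} {F : Type*} [NormedAddCommGroup F] [NormedSpace ℝ F]
    (i : Fin n) (f : EuclideanSpace ℝ (Fin n) → F) : EuclideanSpace ℝ (Fin n) → F :=
  fun x => lineDeriv ℝ f x (EuclideanSpace.single i 1)

/-- The mixed partial derivative `D^ν` associated with a multi-index `ν`. -/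
noncomputable def multiDeriv {n : ℕ} {F : Type*} [NormedAddCommGroup F] [NormedSpace ℝ F]
    (ν : Fin n → ℕ) (f : EuclideanSpace ℝ (Fin n) → F) : EuclideanSpace ℝ (Fin n) → F :=
  (List.finRange n).foldr (fun i g => (pderivI i)^[ν i] g) f

open scoped BigOperators

/-- The support of a distribution (continuous linear functional on Schwartz space):
the set of points having no neighborhood on which the distribution vanishes. -/
def distSupp {n : ℕ} (T : SchwartzMap (EuclideanSpace ℝ (Fin n)) ℂ →L[ℂ] ℂ) :
    Set (EuclideanSpace ℝ (Fin n)) :=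
  {x | ∀ U ∈ nhds x, ∃ φ : SchwartzMap (EuclideanSpace ℝ (Fin n)) ℂ,
    tsupport (φ : EuclideanSpace ℝ (Fin n) → ℂ) ⊆ U ∧ T φ ≠ 0}

open SchwartzMap LineDeriv
open scoped ContDiff Topology

section PointSupport
variable {E : Type*} [NormedAddCommGroup E] [NormedSpace ℝ E]

lemma ps_bound (T : 𝓢(E, ℂ) →L[ℂ] ℂ) :
    ∃ (N : ℕ) (C : ℝ), 0 ≤ C ∧ ∀ (φ : 𝓢(E, ℂ)) (M : ℝ), 0 ≤ M →
      (∀ k ≤ N, ∀ l ≤ N, ∀ x, ‖x‖ ^ k * ‖iteratedFDeriv ℝ l φ x‖ ≤ M) → ‖T φ‖ ≤ C * M := by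
  obtain ⟨s, C, -, hC⟩ := Seminorm.bound_of_continuous (schwartz_withSeminorms ℂ E ℂ)
    ((normSeminorm ℂ ℂ).comp T.toLinearMap) (by
      show Continuous fun φ => ‖T φ‖
      fun_prop)
  refine ⟨s.sup (fun p => max p.1 p.2), C, C.2, fun φ M hM h => ?_⟩
  have h1 := hC φ
  have h2 : (s.sup (schwartzSeminormFamily ℂ E ℂ)) φ ≤ M := by
    apply Seminorm.finset_sup_apply_le hM
    intro p hp
    have := Finset.le_sup (f := fun p : ℕ × ℕ => max p.1 p.2) hp
    exact SchwartzMap.seminorm_le_bound ℂ p.1 p.2 φ hM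
      (h p.1 ((le_max_left _ _).trans this) p.2 ((le_max_right _ _).trans this))
  calc ‖T φ‖ ≤ C * (s.sup (schwartzSeminormFamily ℂ E ℂ)) φ := h1
    _ ≤ C * M := by gcongr

lemma ps_mul_bound (T : 𝓢(E, ℂ) →L[ℂ] ℂ) :
    ∃ (N : ℕ) (C : ℝ), 0 ≤ C ∧ ∀ (φ : 𝓢(E, ℂ)) (g : E → ℝ) (M : ℝ), g.HasTemperateGrowth → 0 ≤ M →
      (∀ k ≤ N, ∀ i j, i + j ≤ N → ∀ x,
        ‖x‖ ^ k * (‖iteratedFDeriv ℝ i g x‖ * ‖iteratedFDeriv ℝ j φ x‖) ≤ M) →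
      ‖T (smulLeftCLM ℂ g φ)‖ ≤ C * M := by
  obtain ⟨N, C, hC, h⟩ := ps_bound T
  refine ⟨N, C * 2 ^ N, by positivity, fun φ g M hg hM hb => ?_⟩
  rw [mul_assoc]
  apply h _ _ (by positivity)
  intro k hk l hl x
  rw [smulLeftCLM_apply hg]
  have h1 := norm_iteratedFDeriv_smul_le (𝕜 := ℝ) (N := ∞) hg.1 (φ.smooth ⊤) x (n := l) (mod_cast le_top)
  calc _ ≤ ‖x‖ ^ k * ∑ i ∈ Finset.range (l + 1), (l.choose i : ℝ) * ‖iteratedFDeriv ℝ i g x‖ *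
        ‖iteratedFDeriv ℝ (l - i) φ x‖ := by gcongr
    _ = ∑ i ∈ Finset.range (l + 1), (l.choose i : ℝ) * (‖x‖ ^ k * (‖iteratedFDeriv ℝ i g x‖ *
        ‖iteratedFDeriv ℝ (l - i) φ x‖)) := by
      rw [Finset.mul_sum]; congr 1; ext i; ring
    _ ≤ ∑ i ∈ Finset.range (l + 1), (l.choose i : ℝ) * M := by
      gcongr with i hi
      apply hb k hk
      simp at hi; omega
    _ = 2 ^ l * M := by
      rw [← Finset.sum_mul]
      congr 1
      exact_mod_cast Nat.sum_range_choose l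
    _ ≤ 2 ^ N * M := by gcongr; norm_num

/-- Taylor vanishing. -/
lemma ps_taylor (φ : 𝓢(E, ℂ)) (x₀ : E) (N : ℕ) (h : ∀ j ≤ N, iteratedFDeriv ℝ j φ x₀ = 0) :
    ∃ C : ℝ, 0 ≤ C ∧ ∀ d j, j + d = N + 1 → ∀ x, ‖iteratedFDeriv ℝ j φ x‖ ≤ C * ‖x - x₀‖ ^ d := by
  refine ⟨SchwartzMap.seminorm ℝ 0 (N+1) φ, apply_nonneg _ _, fun d => ?_⟩
  induction d with
  | zero =>
    intro j hj x
    obtain rfl : j = N + 1 := by omega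
    simpa using SchwartzMap.norm_iteratedFDeriv_le_seminorm ℝ φ (N+1) x
  | succ d ih =>
    intro j hj x
    have := (convex_closedBall x₀ ‖x - x₀‖).norm_image_sub_le_of_norm_fderiv_le (𝕜 := ℝ)
      (f := iteratedFDeriv ℝ j φ) (C := SchwartzMap.seminorm ℝ 0 (N+1) φ * ‖x - x₀‖ ^ d)
      (x := x₀) (y := x)
      (fun y _ => (φ.smooth ⊤).differentiable_iteratedFDeriv (mod_cast ENat.natCast_lt_top j) y)
      (fun y hy => by
        rw [norm_fderiv_iteratedFDeriv]
        refine (ih (j+1) (by omega) y).trans ?_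
        rw [mem_closedBall_iff_norm] at hy
        gcongr) (by simp) (by simp [dist_eq_norm])
    rw [h j (by omega), sub_zero] at this
    rw [pow_succ, ← mul_assoc]
    exact this

lemma ps_cutoff [FiniteDimensional ℝ E] [HasContDiffBump E] : ∃ χ : 𝓢(E, ℝ), (∀ x, ‖x‖ ≤ 1 → χ x = 1) ∧
    (∀ x, x ∈ tsupport χ → ‖x‖ ≤ 2) := by
  let b : ContDiffBump (0 : E) := ⟨1, 2, by norm_num, by norm_num⟩
  refine ⟨b.hasCompactSupport.toSchwartzMap b.contDiff, fun x hx => ?_, fun x hx => ?_⟩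
  · exact b.one_of_mem_closedBall (by simpa using hx)
  · have : x ∈ tsupport b := hx
    rw [b.tsupport_eq] at this
    simpa using this

lemma ps_scale_deriv (χ : 𝓢(E, ℝ)) (x₀ : E) (t : ℝ) (i : ℕ) (x : E) :
    iteratedFDeriv ℝ i (fun x => χ (t • (x - x₀))) x = t ^ i • iteratedFDeriv ℝ i χ (t • (x - x₀)) := by
  have := iteratedFDeriv_comp_sub (𝕜 := ℝ) (f := fun x => χ (t • x)) i x₀ x
  rw [this, iteratedFDeriv_comp_const_smul t (χ.smooth i)]

lemma ps_scale_temperate (χ : 𝓢(E, ℝ)) (x₀ : E) (t : ℝ) :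
    (fun x => χ (t • (x - x₀))).HasTemperateGrowth := by
  have h : Function.HasTemperateGrowth χ := χ.hasTemperateGrowth
  apply h.comp
  fun_prop

lemma ps_unif {F : Type*} [NormedAddCommGroup F] [NormedSpace ℝ F] (φ : 𝓢(E, F)) (N : ℕ) :
    ∃ B : ℝ, 0 ≤ B ∧ ∀ k ≤ N, ∀ j ≤ N, ∀ y, ‖y‖ ^ k * ‖iteratedFDeriv ℝ j φ y‖ ≤ B := by
  refine ⟨∑ k ∈ Finset.range (N + 1), ∑ j ∈ Finset.range (N + 1), SchwartzMap.seminorm ℝ k j φ,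
    Finset.sum_nonneg fun _ _ => Finset.sum_nonneg fun _ _ => apply_nonneg _ _, ?_⟩
  exact fun k hk j hj y => (SchwartzMap.le_seminorm ℝ k j φ y).trans
    ((Finset.single_le_sum (f := fun j => SchwartzMap.seminorm ℝ k j φ)
      (fun i _ => apply_nonneg _ _) (by simp; omega)).trans
      (Finset.single_le_sum
        (f := fun k => ∑ j ∈ Finset.range (N + 1), SchwartzMap.seminorm ℝ k j φ)
      (fun i _ => Finset.sum_nonneg fun _ _ => apply_nonneg _ _) (by simp; omega)))

lemma ps_smul_const_sub (g : E → ℝ) (hg : g.HasTemperateGrowth) (φ : 𝓢(E, ℂ)) :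
    smulLeftCLM ℂ (fun x => 1 - g x) φ = φ - smulLeftCLM ℂ g φ := by
  ext x
  rw [smulLeftCLM_apply_apply (by fun_prop)]
  simp [smulLeftCLM_apply_apply hg, sub_mul]

/-- Finite covering argument. -/
lemma ps_compact [FiniteDimensional ℝ E] [HasContDiffBump E] (T : 𝓢(E, ℂ) →L[ℂ] ℂ)
    (K : Set E) (hK : IsCompact K)
    (h : ∀ x ∈ K, ∃ U ∈ 𝓝 x, ∀ φ : 𝓢(E, ℂ), tsupport φ ⊆ U → T φ = 0) :
    ∃ g : E → ℝ, g.HasTemperateGrowth ∧ (∀ x ∈ K, g x = 1) ∧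
      ∀ φ : 𝓢(E, ℂ), T (smulLeftCLM ℂ g φ) = 0 := by
  refine hK.induction_on (p := fun K => ∃ g : E → ℝ, g.HasTemperateGrowth ∧ (∀ x ∈ K, g x = 1) ∧
      ∀ φ : 𝓢(E, ℂ), T (smulLeftCLM ℂ g φ) = 0) ?_ ?_ ?_ ?_
  · exact ⟨fun _ => 0, by fun_prop, by simp, by simp⟩
  · rintro s t hst ⟨g, h1, h2, h3⟩
    exact ⟨g, h1, fun x hx => h2 x (hst hx), h3⟩
  · rintro s t ⟨g, h1, h2, h3⟩ ⟨g', h1', h2', h3'⟩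
    refine ⟨g + g' - g * g', (h1.add h1').sub (h1.mul h1'), ?_, fun φ => ?_⟩
    · rintro x (hx | hx)
      · simp [h2 x hx]
      · simp [h2' x hx]
    · rw [smulLeftCLM_sub (h1.add h1') (h1.mul h1'), smulLeftCLM_add h1 h1',
        ← smulLeftCLM_compL_smulLeftCLM h1 h1']
      simp [h3, h3']
  · intro x hx
    obtain ⟨U, hU, hv⟩ := h x hx
    obtain ⟨r, hr, hrU⟩ := Metric.nhds_basis_closedBall.mem_iff.1 hU
    let b : ContDiffBump x := ⟨r / 2, r, by positivity, by linarith⟩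
    have hb : Function.HasTemperateGrowth b := b.hasCompactSupport.hasTemperateGrowth b.contDiff
    refine ⟨Metric.closedBall x (r / 2), mem_nhdsWithin_of_mem_nhds
      (Metric.closedBall_mem_nhds x (by positivity)), b, hb, fun y hy => b.one_of_mem_closedBall hy,
      fun φ => hv _ ?_⟩
    refine (tsupport_smulLeftCLM_subset _ _).trans (Set.inter_subset_right.trans ?_)
    rw [b.tsupport_eq]
    exact hrU

lemma ps_away [FiniteDimensional ℝ E] [HasContDiffBump E] (T : 𝓢(E, ℂ) →L[ℂ] ℂ) (x₀ : E)
    (h : ∀ x, x ≠ x₀ → ∃ U ∈ 𝓝 x, ∀ φ : 𝓢(E, ℂ), tsupport φ ⊆ U → T φ = 0)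
    (φ : 𝓢(E, ℂ)) (hφ : x₀ ∉ tsupport φ) : T φ = 0 := by
  have hc : ∀ ψ : 𝓢(E, ℂ), x₀ ∉ tsupport ψ → HasCompactSupport ψ → T ψ = 0 := by
    intro ψ h1 h2
    obtain ⟨g, hg, hg1, hg2⟩ := ps_compact T (tsupport ψ) h2
      (fun x hx => h x (fun hxx => h1 (hxx ▸ hx)))
    rw [← hg2 ψ]
    congr 1
    ext x
    rw [smulLeftCLM_apply_apply hg]
    by_cases hx : x ∈ tsupport ψ
    · simp [hg1 x hx]
    · simp [image_eq_zero_of_notMem_tsupport hx]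
  obtain ⟨χ, hχ1, hχ2⟩ := ps_cutoff (E := E)
  obtain ⟨N, C, hC, hT⟩ := ps_mul_bound T
  -- uniform bound
  obtain ⟨M, hM0, hM⟩ : ∃ M : ℝ, 0 ≤ M ∧ ∀ t : ℝ, 0 < t → t ≤ 1 →
      ∀ k ≤ N, ∀ i j, i + j ≤ N → ∀ x,
        ‖x‖ ^ k * (‖iteratedFDeriv ℝ i (fun x => 1 - χ (t • (x - x₀))) x‖ * ‖iteratedFDeriv ℝ j φ x‖)
          ≤ M * t := by
    obtain ⟨A, hA0, hA'⟩ := ps_unif χ N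
    obtain ⟨B, hB0, hB⟩ := ps_unif φ (N + 1)
    have hA : ∀ i ≤ N, ∀ y, ‖iteratedFDeriv ℝ i χ y‖ ≤ A := fun i hi y => by
      simpa using hA' 0 (by omega) i hi y
    refine ⟨(1 + A) * ((2 + ‖x₀‖) * B), by positivity, fun t ht ht1 k hk i j hij x => ?_⟩
    have key : ‖iteratedFDeriv ℝ i (fun x => 1 - χ (t • (x - x₀))) x‖ ≤
        (1 + A) * (t * (‖x‖ + 1 + ‖x₀‖)) := by
      rcases Nat.eq_zero_or_pos i with rfl | hi
      · rw [norm_iteratedFDeriv_zero]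
        by_cases hx : ‖t • (x - x₀)‖ ≤ 1
        · rw [hχ1 _ hx]; simp; positivity
        · have h1 : ‖1 - χ (t • (x - x₀))‖ ≤ 1 + A := by
            refine (norm_sub_le _ _).trans ?_
            have := hA 0 (by omega) (t • (x - x₀))
            rw [norm_iteratedFDeriv_zero] at this
            simpa using this
          have h2 : 1 ≤ t * (‖x‖ + 1 + ‖x₀‖) := by
            rw [norm_smul, Real.norm_of_nonneg ht.le] at hx
            have := norm_sub_le x x₀
            nlinarith
          nlinarith
      · have e : iteratedFDeriv ℝ i (fun x => 1 - χ (t • (x - x₀))) x =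
            - iteratedFDeriv ℝ i (fun x => χ (t • (x - x₀))) x := by
          have := iteratedFDeriv_sub_apply (𝕜 := ℝ) (i := i) (x := x) (f := fun _ : E => (1 : ℝ))
            (g := fun x => χ (t • (x - x₀))) contDiffAt_const
            ((ps_scale_temperate χ x₀ t).1.contDiffAt.of_le (mod_cast le_top))
          have h0 : (fun x => 1 - χ (t • (x - x₀))) = (fun _ : E => (1 : ℝ)) - (fun x => χ (t • (x - x₀))) := rfl
          rw [h0, this, iteratedFDeriv_const_of_ne (by omega)]
          simp
        rw [e, norm_neg, ps_scale_deriv, norm_smul, norm_pow, Real.norm_of_nonneg ht.le]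
        have h1 : t ^ i ≤ t := pow_le_of_le_one ht.le ht1 (by omega)
        calc t ^ i * _ ≤ t * A := by
              gcongr
              exact hA i (by omega) _
          _ ≤ (1 + A) * (t * 1) := by nlinarith
          _ ≤ _ := by
            gcongr
            have := norm_nonneg x
            have := norm_nonneg x₀
            linarith
    calc _ ≤ ‖x‖ ^ k * (((1 + A) * (t * (‖x‖ + 1 + ‖x₀‖))) * ‖iteratedFDeriv ℝ j φ x‖) := by gcongr
      _ = (1 + A) * t * (‖x‖ ^ (k+1) * ‖iteratedFDeriv ℝ j φ x‖ +
            (1 + ‖x₀‖) * (‖x‖ ^ k * ‖iteratedFDeriv ℝ j φ x‖)) := by ring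
      _ ≤ (1 + A) * t * (B + (1 + ‖x₀‖) * B) := by
        gcongr
        · exact hB _ (by omega) _ (by omega) _
        · exact hB _ (by omega) _ (by omega) _
      _ = _ := by ring
  have hmain : ∀ t : ℝ, 0 < t → t ≤ 1 → ‖T φ‖ ≤ C * (M * t) := by
    intro t ht ht1
    have hg := ps_scale_temperate χ x₀ t
    have h1 : T (smulLeftCLM ℂ (fun x => χ (t • (x - x₀))) φ) = 0 := by
      have hsub := tsupport_smulLeftCLM_subset (fun x => χ (t • (x - x₀))) φ
      apply hc
      · exact fun hx => hφ (hsub hx).1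
      · apply HasCompactSupport.of_support_subset_isCompact (isCompact_closedBall x₀ (2 / t))
        intro x hx
        have hx' : t • (x - x₀) ∈ tsupport χ := by
          by_contra hcon
          apply hx
          rw [smulLeftCLM_apply_apply hg, image_eq_zero_of_notMem_tsupport hcon, zero_smul]
        have := hχ2 _ hx'
        rw [norm_smul, Real.norm_of_nonneg ht.le] at this
        rw [mem_closedBall_iff_norm, le_div_iff₀ ht]
        linarith
    have h2 := hT φ (fun x => 1 - χ (t • (x - x₀))) (M * t) (by fun_prop) (by positivity) (hM t ht ht1)
    rw [ps_smul_const_sub _ hg, map_sub, h1, sub_zero] at h2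
    exact h2
  have hlim : Filter.Tendsto (fun t : ℝ => C * (M * t)) (𝓝[>] 0) (𝓝 0) := by
    have : Continuous fun t : ℝ => C * (M * t) := by fun_prop
    simpa using (this.tendsto 0).mono_left nhdsWithin_le_nhds
  have : ‖T φ‖ ≤ 0 := by
    apply ge_of_tendsto hlim
    filter_upwards [Ioc_mem_nhdsGT (zero_lt_one (α := ℝ))] with t ht using hmain t ht.1 ht.2
  simpa using this

lemma ps_order [FiniteDimensional ℝ E] [HasContDiffBump E] (T : 𝓢(E, ℂ) →L[ℂ] ℂ) (x₀ : E)
    (h : ∀ x, x ≠ x₀ → ∃ U ∈ 𝓝 x, ∀ φ : 𝓢(E, ℂ), tsupport φ ⊆ U → T φ = 0) :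
    ∃ N : ℕ, ∀ φ : 𝓢(E, ℂ), (∀ j ≤ N, iteratedFDeriv ℝ j φ x₀ = 0) → T φ = 0 := by
  obtain ⟨χ, hχ1, hχ2⟩ := ps_cutoff (E := E)
  obtain ⟨N, C, hC, hT⟩ := ps_mul_bound T
  refine ⟨N, fun φ hφ => ?_⟩
  obtain ⟨B, hB0, hB⟩ := ps_taylor φ x₀ N hφ
  obtain ⟨A, hA0, hA'⟩ := ps_unif χ N
  have hA : ∀ i ≤ N, ∀ y, ‖iteratedFDeriv ℝ i χ y‖ ≤ A := fun i hi y => by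
    simpa using hA' 0 (by omega) i hi y
  obtain ⟨R, hR⟩ : ∃ R : ℝ, R = 2 + ‖x₀‖ := ⟨_, rfl⟩
  have hR1 : 1 ≤ R := by have := norm_nonneg x₀; linarith
  have hmain : ∀ t : ℝ, 0 < t → t ≤ 1 → ‖T φ‖ ≤ C * ((R ^ N * (A * (B * 2 ^ (N + 1)))) * t) := by
    intro t ht ht1
    have hg := ps_scale_temperate χ x₀ t⁻¹
    have h1 : T (smulLeftCLM ℂ (fun x => 1 - χ (t⁻¹ • (x - x₀))) φ) = 0 := by
      apply ps_away T x₀ h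
      rw [notMem_tsupport_iff_eventuallyEq]
      filter_upwards [Metric.closedBall_mem_nhds x₀ ht] with x hx
      rw [smulLeftCLM_apply_apply (by fun_prop), hχ1]
      · simp
      · rw [norm_smul, Real.norm_of_nonneg (by positivity), inv_mul_le_one₀ ht]
        exact mem_closedBall_iff_norm.1 hx
    rw [ps_smul_const_sub _ hg, map_sub, sub_eq_zero] at h1
    rw [h1]
    apply hT φ _ _ hg (by positivity)
    intro k hk i j hij x
    rw [ps_scale_deriv]
    by_cases hx : t⁻¹ • (x - x₀) ∈ tsupport χ
    · have hx1 := hχ2 _ hx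
      rw [norm_smul, Real.norm_of_nonneg (by positivity), inv_mul_le_iff₀ ht] at hx1
      have hx2 : ‖x‖ ≤ R := by
        have := norm_sub_norm_le x x₀
        linarith
      obtain ⟨d, hd⟩ : ∃ d, j + (i + (d + 1)) = N + 1 := ⟨N - j - i, by omega⟩
      have h3 := hB _ j hd x
      rw [norm_smul, norm_pow, Real.norm_of_nonneg (by positivity)]
      calc _ ≤ R ^ N * ((t⁻¹ ^ i * A) * (B * (t * 2) ^ (i + (d + 1)))) := by
            gcongr
            · exact (pow_le_pow_left₀ (norm_nonneg _) hx2 k).trans (pow_le_pow_right₀ hR1 hk)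
            · exact hA i (by omega) _
            · exact h3.trans (by gcongr)
        _ = R ^ N * (A * (B * 2 ^ (i + (d + 1)))) * ((t⁻¹ * t) ^ i * (t ^ d * t)) := by ring
        _ = R ^ N * (A * (B * 2 ^ (i + (d + 1)))) * (t ^ d * t) := by
            rw [inv_mul_cancel₀ ht.ne', one_pow, one_mul]
        _ ≤ R ^ N * (A * (B * 2 ^ (N + 1))) * (1 * t) := by
            have e1 : i + (d + 1) ≤ N + 1 := by omega
            generalize i + (d + 1) = e at e1
            gcongr
            · norm_num
            · exact pow_le_one₀ ht.le ht1
        _ = _ := by rw [one_mul]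
    · have : iteratedFDeriv ℝ i χ (t⁻¹ • (x - x₀)) = 0 := by
        by_contra hcon
        exact hx (support_iteratedFDeriv_subset i hcon)
      rw [this]
      simp
      positivity
  have hlim : Filter.Tendsto (fun t : ℝ => C * ((R ^ N * (A * (B * 2 ^ (N + 1)))) * t))
      (𝓝[>] 0) (𝓝 0) := by
    have : Continuous fun t : ℝ => C * ((R ^ N * (A * (B * 2 ^ (N + 1)))) * t) := by fun_prop
    simpa using (this.tendsto 0).mono_left nhdsWithin_le_nhds
  have : ‖T φ‖ ≤ 0 := by
    apply ge_of_tendsto hlim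
    filter_upwards [Ioc_mem_nhdsGT (zero_lt_one (α := ℝ))] with t ht using hmain t ht.1 ht.2
  simpa using this
end PointSupport

section PointSupportAlg
variable {n : ℕ}

/-- Partial derivative on Schwartz space as an endomorphism. -/
noncomputable def psP (i : Fin n) :
    Module.End ℂ (𝓢(EuclideanSpace ℝ (Fin n), ℂ)) :=
  (lineDerivOpCLM ℂ 𝓢(EuclideanSpace ℝ (Fin n), ℂ)
    (EuclideanSpace.single i (1 : ℝ))).toLinearMap

/-- Mixed partial derivative on Schwartz space. -/
noncomputable def psM (ν : Fin n → ℕ) :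
    Module.End ℂ (𝓢(EuclideanSpace ℝ (Fin n), ℂ)) :=
  ((List.finRange n).map (fun i => psP i ^ ν i)).prod

lemma psP_apply (i : Fin n) (φ : 𝓢(EuclideanSpace ℝ (Fin n), ℂ)) :
    psP i φ = ∂_{EuclideanSpace.single i (1 : ℝ)} φ := rfl

lemma psP_coe (i : Fin n) (φ : 𝓢(EuclideanSpace ℝ (Fin n), ℂ)) :
    (psP i φ : EuclideanSpace ℝ (Fin n) → ℂ) = pderivI i φ := by
  ext x
  rw [psP_apply, lineDerivOp_apply]
  rfl

lemma psP_pow_coe (i : Fin n) (k : ℕ) (φ : 𝓢(EuclideanSpace ℝ (Fin n), ℂ)) :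
    ((psP i ^ k) φ : EuclideanSpace ℝ (Fin n) → ℂ) = (pderivI i)^[k] φ := by
  induction k with
  | zero => simp
  | succ k ih =>
    rw [pow_succ', Module.End.mul_apply, psP_coe, ih, Function.iterate_succ_apply']

lemma psM_coe (ν : Fin n → ℕ) (φ : 𝓢(EuclideanSpace ℝ (Fin n), ℂ)) :
    (psM ν φ : EuclideanSpace ℝ (Fin n) → ℂ) = multiDeriv ν φ := by
  unfold psM multiDeriv
  induction List.finRange n with
  | nil => simp
  | cons i l ih =>
    rw [List.map_cons, List.prod_cons, Module.End.mul_apply, psP_pow_coe, ih, List.foldr_cons]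

lemma psP_comm (i j : Fin n) : Commute (psP i) (psP j) := by
  refine LinearMap.ext fun φ => SchwartzMap.ext fun x => ?_
  simp only [Module.End.mul_apply, psP_apply]
  have hs : IsSymmSndFDerivAt ℝ φ x := (φ.contDiffAt 2).isSymmSndFDerivAt (by simp)
  have key : ∀ v w : EuclideanSpace ℝ (Fin n),
      (∂_{v} (∂_{w} φ)) x = fderiv ℝ (fderiv ℝ φ) x v w := by
    intro v w
    have h1 : ⇑(∂_{w} φ : 𝓢(EuclideanSpace ℝ (Fin n), ℂ)) = fun y => fderiv ℝ φ y w := by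
      ext y; rw [lineDerivOp_apply_eq_fderiv]
    rw [lineDerivOp_apply_eq_fderiv, h1, fderiv_clm_apply]
    · simp
    · exact (((φ.smooth 2).fderiv_right (m := 1) (by norm_num [one_add_one_eq_two])).differentiable (by simp)) x
    · fun_prop
  rw [key, key, hs]

lemma psM_succ_aux (i : Fin n) (ν : Fin n → ℕ) (l : List (Fin n)) :
    (l.map (fun j => psP j ^ (ν j + if j = i then 1 else 0))).prod =
      psP i ^ (l.count i) * (l.map (fun j => psP j ^ ν j)).prod := by
  induction l with
  | nil => simp
  | cons j l ih =>
    simp only [List.map_cons, List.prod_cons, ih, List.count_cons]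
    have hc := (psP_comm j i).pow_pow (ν j) (l.count i)
    by_cases hj : j = i
    · subst hj
      simp only [beq_self_eq_true, if_true, ← mul_assoc, ← pow_add]
      congr 2; omega
    · simp only [hj, if_false, beq_iff_eq, add_zero, ← mul_assoc, hc.eq]

lemma psM_succ (i : Fin n) (ν : Fin n → ℕ) :
    psM (fun j => ν j + if j = i then 1 else 0) = psP i * psM ν := by
  unfold psM
  rw [psM_succ_aux, List.count_eq_one_of_mem (List.nodup_finRange n) (List.mem_finRange i), pow_one]

lemma ps_iter (k : ℕ) (m : Fin k → Fin n) (φ : 𝓢(EuclideanSpace ℝ (Fin n), ℂ)) :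
    ∃ ν : Fin n → ℕ, ∑ i, ν i = k ∧
      ∂^{fun a => EuclideanSpace.single (m a) (1 : ℝ)} φ = psM ν φ := by
  induction k with
  | zero => exact ⟨0, by simp, by simp [psM]⟩
  | succ k ih =>
    obtain ⟨ν, h1, h2⟩ := ih (fun a => m a.succ)
    refine ⟨fun j => ν j + if j = m 0 then 1 else 0, by simp [Finset.sum_add_distrib, h1], ?_⟩
    rw [psM_succ, Module.End.mul_apply, ← h2, psP_apply, iteratedLineDerivOp_succ_left]
    rfl

lemma ps_fderiv_zero (N : ℕ) (x₀ : EuclideanSpace ℝ (Fin n))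
    (φ : 𝓢(EuclideanSpace ℝ (Fin n), ℂ))
    (h : ∀ ν : Fin n → ℕ, ∑ i, ν i ≤ N → psM ν φ x₀ = 0) :
    ∀ j ≤ N, iteratedFDeriv ℝ j φ x₀ = 0 := by
  intro j hj
  apply ContinuousMultilinearMap.toMultilinearMap_injective
  refine Module.Basis.ext_multilinear
    (fun _ => (EuclideanSpace.basisFun (Fin n) ℝ).toBasis) fun v => ?_
  obtain ⟨ν, h1, h2⟩ := ps_iter j v φ
  have := h ν (by omega)
  rw [← h2, iteratedLineDerivOp_eq_iteratedFDeriv] at this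
  simpa using this

end PointSupportAlg

/-- A distribution supported at a single point `x₀` is a finite linear combination of
derivatives of the Dirac delta at `x₀`:  `T = ∑_{|ν| ≤ m} c_ν D^ν δ_{x₀}`, i.e.
`T φ = ∑_{|ν| ≤ m} c_ν (−1)^{|ν|} (D^ν φ)(x₀)`. -/
theorem stmt_7 (n : ℕ) (x₀ : EuclideanSpace ℝ (Fin n))
    (T : SchwartzMap (EuclideanSpace ℝ (Fin n)) ℂ →L[ℂ] ℂ)
    (hT : distSupp T = {x₀}) :
    ∃ (m : ℕ) (c : (Fin n → Fin (m + 1)) → ℂ),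
      ∀ φ : SchwartzMap (EuclideanSpace ℝ (Fin n)) ℂ,
        T φ = ∑ ν : Fin n → Fin (m + 1),
          if (∑ i, (ν i : ℕ)) ≤ m then
            c ν * (-1) ^ (∑ i, (ν i : ℕ)) *
              multiDeriv (fun i => (ν i : ℕ)) (φ : EuclideanSpace ℝ (Fin n) → ℂ) x₀
          else 0 := by
  have hloc : ∀ x, x ≠ x₀ → ∃ U ∈ 𝓝 x, ∀ φ : 𝓢(EuclideanSpace ℝ (Fin n), ℂ),
      tsupport φ ⊆ U → T φ = 0 := by
    intro x hx
    have : x ∉ distSupp T := by rw [hT]; exact hx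
    simp only [distSupp, Set.mem_ofPred_eq] at this
    push Not at this
    exact this
  obtain ⟨m, hm⟩ := ps_order T x₀ hloc
  let ev : 𝓢(EuclideanSpace ℝ (Fin n), ℂ) →ₗ[ℂ] ℂ :=
    { toFun := fun φ => φ x₀, map_add' := fun _ _ => rfl, map_smul' := fun _ _ => rfl }
  let L : (Fin n → Fin (m + 1)) → 𝓢(EuclideanSpace ℝ (Fin n), ℂ) →ₗ[ℂ] ℂ := fun ν =>
    if (∑ i, (ν i : ℕ)) ≤ m then ev ∘ₗ psM (fun i => (ν i : ℕ)) else 0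
  have hker : ⨅ ν, LinearMap.ker (L ν) ≤ LinearMap.ker (T : 𝓢(EuclideanSpace ℝ (Fin n), ℂ) →ₗ[ℂ] ℂ) := by
    intro φ hφ
    simp only [Submodule.mem_iInf, LinearMap.mem_ker] at hφ
    rw [LinearMap.mem_ker]
    apply hm φ
    apply ps_fderiv_zero
    intro ν hν
    have hlt : ∀ i, ν i < m + 1 := fun i =>
      Nat.lt_succ_of_le ((Finset.single_le_sum (fun _ _ => Nat.zero_le _) (Finset.mem_univ i)).trans hν)
    have := hφ (fun i => ⟨ν i, hlt i⟩)
    simp only [L, hν, if_true] at this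
    exact this
  obtain ⟨c, hc⟩ := (Submodule.mem_span_range_iff_exists_fun ℂ).1 (mem_span_of_iInf_ker_le_ker hker)
  refine ⟨m, fun ν => c ν * (-1) ^ (∑ i, (ν i : ℕ)), fun φ => ?_⟩
  have h1 : T φ = ∑ ν, c ν * L ν φ := by
    have := congrArg (fun l => l φ) hc
    simp only [LinearMap.sum_apply, LinearMap.smul_apply, smul_eq_mul] at this
    exact this.symm
  rw [h1]
  refine Finset.sum_congr rfl fun ν _ => ?_
  by_cases hν : (∑ i, (ν i : ℕ)) ≤ m
  · have h2 : L ν φ = multiDeriv (fun i => (ν i : ℕ)) φ x₀ := by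
      simp only [L, hν, if_true, ← psM_coe]
      rfl
    rw [if_pos hν, h2, mul_assoc (c ν), ← mul_pow]
    simp
  · simp [L, hν]
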